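/- arXiv:2409.07840 — 3 statements merged into one kernel-verified Lean document; each statement's English description precedes it below -/
import Mathlib

section
/- Let f_1, …, f_z be the LZ-End parsing of a string S with z ≥ 2, and let α be a single character. If there exists p with 0 ≤ p ≤ z−2 such that the suffix of S of length |f_{z−1}| + |f_z| (that is, the string f_{z−1} f_z) is a suffix of f_1 ⋯ f_p, then the LZ-End parsing of Sα is f_1, …, f_{z−2}, g where g = f_{z−1} f_z α. -/
/-- `IsLZEnd S fs` states that `fs = [f₁, …, f_z]` is the (greedy) LZ-End parsing of `S`:
the phrases concatenate to `S`; each phrase is nonempty; for each phrase `f_i`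
(0-based index `k`, so `i = k+1`) starting at position `b = |f₁⋯f_k|`, the phrase without its
last character is a suffix of `f₁⋯f_p` for some `p < i` (i.e. `p ≤ k` with `f₁⋯f₀ = ε`);
and its copyable part has maximal length: any `ℓ` with `b + ℓ + 1 ≤ |S|` such that
`S[b..b+ℓ-1]` is a suffix of some `f₁⋯f_p` with `p ≤ k` satisfies `ℓ ≤ |f_i| - 1`. -/
def IsLZEnd {α : Type*} (S : List α) (fs : List (List α)) : Prop :=
  fs.flatten = S ∧
  ∀ k, (hk : k < fs.length) →
    1 ≤ fs[k].length ∧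
    (∃ p ≤ k, fs[k].dropLast <:+ (fs.take p).flatten) ∧
    (∀ ℓ, ((fs.take k).flatten).length + ℓ + 1 ≤ S.length →
      (∃ p ≤ k, (S.drop ((fs.take k).flatten).length).take ℓ <:+ (fs.take p).flatten) →
      ℓ + 1 ≤ fs[k].length)

theorem List.flatten_take_succ_eq {α : Type*} (fs : List (List α)) {k : ℕ} (hk : k < fs.length) :
    (fs.take (k + 1)).flatten = (fs.take k).flatten ++ fs[k] := by
  rw [← List.take_concat_get' fs k hk, List.flatten_append, List.flatten_singleton]

theorem List.flatten_drop_eq_getElem_append {α : Type*} (fs : List (List α)) {k : ℕ}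
    (hk : k < fs.length) :
    (fs.drop k).flatten = fs[k] ++ (fs.drop (k + 1)).flatten := by
  rw [List.drop_eq_getElem_cons hk, List.flatten_cons]

theorem List.flatten_take_append_flatten_drop {α : Type*} (fs : List (List α)) (k : ℕ) :
    (fs.take k).flatten ++ (fs.drop k).flatten = fs.flatten := by
  rw [← List.flatten_append, List.take_append_drop]

theorem List.drop_length_flatten_take {α : Type*} (fs : List (List α)) (k : ℕ) :
    fs.flatten.drop (fs.take k).flatten.length = (fs.drop k).flatten := by
  rw [← fs.flatten_take_append_flatten_drop k, List.drop_left]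

theorem List.IsSuffix.dropLast_of_ne_nil {α : Type*} {l m : List α} (h : l <:+ m) (hl : l ≠ []) :
    l.dropLast <:+ m.dropLast := by
  obtain ⟨t, rfl⟩ := h
  rw [List.dropLast_append_of_ne_nil hl]
  exact List.suffix_append _ _

namespace IsLZEnd

variable {α : Type*} {S : List α} {fs : List (List α)}

/-- The maximality clause, phrased for a proper prefix `w` of the text that remains unparsed. -/
theorem length_lt_of_copy (h : IsLZEnd S fs) {k p : ℕ} (hk : k < fs.length) (hp : p ≤ k)
    {w v : List α} (hv : v ≠ []) (hw : (fs.drop k).flatten = w ++ v)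
    (hs : w <:+ (fs.take p).flatten) : w.length < fs[k].length := by
  obtain ⟨rfl, h⟩ := h
  have hv' := List.length_pos_of_ne_nil hv
  refine (h k hk).2.2 w.length ?_ ⟨p, hp, ?_⟩
  · rw [← fs.flatten_take_append_flatten_drop k, hw]
    simp only [List.length_append]
    omega
  · rwa [List.drop_length_flatten_take, hw, List.take_left]

theorem getElem_ne_nil (h : IsLZEnd S fs) {k : ℕ} (hk : k < fs.length) : fs[k] ≠ [] :=
  List.ne_nil_of_length_pos (h.2 k hk).1

theorem flatten_drop_ne_nil (h : IsLZEnd S fs) {k : ℕ} (hk : k < fs.length) :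
    (fs.drop k).flatten ≠ [] := by
  rw [fs.flatten_drop_eq_getElem_append hk]
  simp [h.getElem_ne_nil hk]

/-- Three or more trailing phrases never have an earlier occurrence ending at a phrase boundary. -/
theorem not_flatten_drop_suffix (h : IsLZEnd S fs) {k p : ℕ} (hk : k + 2 < fs.length)
    (hp : p ≤ k) : ¬ (fs.drop k).flatten <:+ (fs.take p).flatten := by
  intro hs
  have e1 := fs.flatten_drop_eq_getElem_append (k := k) (by omega)
  have e2 := fs.flatten_drop_eq_getElem_append (k := k + 1) (by omega)
  have hR := h.flatten_drop_ne_nil (k := k + 1) (by omega)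
  have hR' := h.flatten_drop_ne_nil hk
  rcases p with _ | q
  · exact h.flatten_drop_ne_nil (k := k) (by omega) (by simpa using hs)
  have hq : q < fs.length := by omega
  rw [fs.flatten_take_succ_eq hq] at hs
  by_cases hF : fs[q].length ≤ (fs.drop (k + 1)).flatten.length
  · obtain ⟨t, ht⟩ := hs
    have hlen := congrArg List.length e1
    rw [List.length_append] at hlen
    have hk0 := (h.2 k (by omega)).1
    obtain ⟨x, hP, hx⟩ | ⟨x, -, hx⟩ := List.append_eq_append_iff.1 ht
    · have := h.length_lt_of_copy (by omega) (by omega : q ≤ k) (h.getElem_ne_nil hq) hx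
        (hP ▸ List.suffix_append _ _)
      have := congrArg List.length hx
      rw [List.length_append] at this
      omega
    · have := congrArg List.length hx
      rw [List.length_append] at this
      omega
  · have hRF : (fs.drop (k + 1)).flatten <:+ fs[q] :=
      List.suffix_of_suffix_length_le
        ((e1 ▸ List.suffix_append _ _ : (fs.drop (k + 1)).flatten <:+ (fs.drop k).flatten).trans hs)
        (List.suffix_append _ _) (by omega)
    obtain ⟨r, hr, hrs⟩ := (h.2 q hq).2.1
    have := h.length_lt_of_copy (k := k + 1) (by omega) (by omega : r ≤ k + 1)
      (List.cons_ne_nil _ []) (List.dropLast_append_getLast hR).symm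
      ((hRF.dropLast_of_ne_nil hR).trans hrs)
    have hpos := List.length_pos_of_ne_nil hR'
    rw [List.length_dropLast] at this
    have := congrArg List.length e2
    rw [List.length_append] at this
    change 0 < (fs.drop (k + 1 + 1)).flatten.length at hpos
    omega

theorem dropLast_append_getLast_append (h : IsLZEnd S fs) {k : ℕ} (hk : k < fs.length) :
    (fs.drop k).flatten = fs[k].dropLast ++
      ([fs[k].getLast (h.getElem_ne_nil hk)] ++ (fs.drop (k + 1)).flatten) := by
  rw [← List.append_assoc, List.dropLast_append_getLast, fs.flatten_drop_eq_getElem_append hk]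

/-- Two parsings that agree on the first `k` phrases have the same unparsed text up to the
appended character. -/
theorem flatten_drop_append_singleton {a : α} {gs : List (List α)} (hfs : IsLZEnd S fs)
    (hgs : IsLZEnd (S ++ [a]) gs) {k : ℕ} (htake : gs.take k = fs.take k) :
    (gs.drop k).flatten = (fs.drop k).flatten ++ [a] := by
  have h := hgs.1
  rw [← hfs.1, ← gs.flatten_take_append_flatten_drop k, ← fs.flatten_take_append_flatten_drop k,
    htake, List.append_assoc] at h
  exact List.append_cancel_left h

theorem lt_length_of_append_singleton {a : α} {gs : List (List α)} (hfs : IsLZEnd S fs)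
    (hgs : IsLZEnd (S ++ [a]) gs) {k : ℕ} (htake : gs.take k = fs.take k) : k < gs.length := by
  by_contra! hk
  have := hfs.flatten_drop_append_singleton hgs htake
  simp [List.drop_eq_nil_of_le hk] at this

/-- Appending a character changes at most the last two phrases. -/
theorem take_eq_take_of_append_singleton {a : α} {gs : List (List α)} (hfs : IsLZEnd S fs)
    (hgs : IsLZEnd (S ++ [a]) gs) {k : ℕ} (hk : k ≤ fs.length - 2) :
    gs.take k = fs.take k := by
  induction k with
  | zero => simp
  | succ k ih =>
    have htake := ih (by omega)
    have htake' {p : ℕ} (hp : p ≤ k) : gs.take p = fs.take p := by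
      simpa [List.take_take, hp] using congrArg (List.take p) htake
    have hkf : k < fs.length := by omega
    have hkg := hfs.lt_length_of_append_singleton hgs htake
    have hdrop := hfs.flatten_drop_append_singleton hgs htake
    have hf := hfs.dropLast_append_getLast_append hkf
    have hg := hgs.dropLast_append_getLast_append hkg
    have hfpos := (hfs.2 k hkf).1
    have hgpos := (hgs.2 k hkg).1
    have hle : fs[k].length ≤ gs[k].length := by
      obtain ⟨p, hp, hs⟩ := (hfs.2 k hkf).2.1
      rw [← htake' hp] at hs
      have := hgs.length_lt_of_copy hkg hp (by simp)
        (hdrop.trans ((congrArg (· ++ [a]) hf).trans (List.append_assoc _ _ _))) hs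
      rw [List.length_dropLast] at this
      omega
    have hge : gs[k].length ≤ fs[k].length := by
      obtain ⟨p, hp, hs⟩ := (hgs.2 k hkg).2.1
      rw [htake' hp] at hs
      obtain ⟨v, hv⟩ : gs[k].dropLast <+: (fs.drop k).flatten := by
        refine List.prefix_of_prefix_length_le (hg ▸ List.prefix_append _ _)
          (hdrop ▸ List.prefix_append _ _) ?_
        have := congrArg List.length (hg.symm.trans hdrop)
        simp only [List.length_append, List.length_singleton] at this
        omega
      rcases eq_or_ne v [] with rfl | hne
      · rw [List.append_nil] at hv
        exact absurd (hv ▸ hs) (hfs.not_flatten_drop_suffix (by omega) hp)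
      · have := hfs.length_lt_of_copy hkf hp hne hv.symm hs
        rw [List.length_dropLast] at this
        omega
    have heq : gs[k] = fs[k] := by
      rw [gs.flatten_drop_eq_getElem_append hkg, fs.flatten_drop_eq_getElem_append hkf,
        List.append_assoc] at hdrop
      exact List.append_inj_left hdrop (le_antisymm hge hle)
    rw [← List.take_concat_get' gs k hkg, ← List.take_concat_get' fs k hkf, htake, heq]

end IsLZEnd

/-- If `z ≥ 2` and the string `f_{z-1} f_z` is a suffix of `f₁⋯f_p` for some `p ≤ z-2`,
then the LZ-End parsing of `Sα` is `f₁, …, f_{z-2}, f_{z-1} f_z α` (the merge case). -/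
theorem lzEnd_merge_case {α : Type*} (S : List α) (a : α)
    (fs gs : List (List α)) (hz : 2 ≤ fs.length)
    (hfs : IsLZEnd S fs) (hgs : IsLZEnd (S ++ [a]) gs)
    (hcopy : ∃ p ≤ fs.length - 2,
      (fs.getD (fs.length - 2) [] ++ fs.getD (fs.length - 1) []) <:+ (fs.take p).flatten) :
    gs = fs.take (fs.length - 2) ++
      [fs.getD (fs.length - 2) [] ++ fs.getD (fs.length - 1) [] ++ [a]] := by
  obtain ⟨p, hp, hs⟩ := hcopy
  set k := fs.length - 2 with hkdef
  have htake := hfs.take_eq_take_of_append_singleton hgs (le_refl k)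
  have hkg := hfs.lt_length_of_append_singleton hgs htake
  have hdrop := hfs.flatten_drop_append_singleton hgs htake
  have hk : fs.getD k [] ++ fs.getD (fs.length - 1) [] = (fs.drop k).flatten := by
    have h1 : k < fs.length := by omega
    have h2 : k + 1 < fs.length := by omega
    rw [show fs.length - 1 = k + 1 by omega, fs.flatten_drop_eq_getElem_append h1,
      fs.flatten_drop_eq_getElem_append h2, List.drop_eq_nil_of_le (by omega : fs.length ≤ k + 1 + 1),
      List.getD_eq_getElem _ _ h1, List.getD_eq_getElem _ _ h2]
    simp
  rw [hk] at hs ⊢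
  have htp : gs.take p = fs.take p := by
    simpa [List.take_take, hp] using congrArg (List.take p) htake
  have hlt := hgs.length_lt_of_copy hkg hp (List.cons_ne_nil a []) hdrop (htp ▸ hs)
  have hsplit := gs.flatten_drop_eq_getElem_append hkg
  have hlast : gs.length ≤ k + 1 := by
    by_contra! hlong
    have hpos := List.length_pos_of_ne_nil (hgs.flatten_drop_ne_nil hlong)
    have := congrArg List.length (hsplit.symm.trans hdrop)
    simp only [List.length_append, List.length_singleton] at this
    omega
  rw [List.drop_eq_nil_of_le hlast, List.flatten_nil, List.append_nil, hdrop] at hsplit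
  rw [hsplit, ← htake, List.take_concat_get' gs k hkg, List.take_of_length_le hlast]
end

section
/- Let f_1, …, f_z (z ≥ 1) be the LZ-End parsing of a string S and let α be a single character. If there is no p with 0 ≤ p ≤ z−1 such that the suffix of S of length |f_z| (that is, the string f_z) is a suffix of f_1 ⋯ f_p, then the LZ-End parsing of Sα is f_1, …, f_z, g where g = α (a new phrase consisting of the single character α). -/
theorem flatten_eq_take_append_getElem_append_drop {α : Type*} (fs : List (List α)) (k : ℕ)
    (hk : k < fs.length) :
    fs.flatten = (fs.take k).flatten ++ (fs[k] ++ (fs.drop (k + 1)).flatten) := by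
  rw [← List.flatten_cons, ← List.drop_eq_getElem_cons hk, ← List.flatten_append,
    List.take_append_drop]

theorem getD_length_sub_one_suffix_flatten_drop {α : Type*} (fs : List (List α)) (k : ℕ)
    (hk : k < fs.length) : fs.getD (fs.length - 1) [] <:+ (fs.drop k).flatten := by
  rcases List.eq_nil_or_concat' fs with rfl | ⟨gs, f, rfl⟩
  · simp at hk
  · rw [List.length_append, List.length_singleton] at hk
    rw [List.drop_append_of_le_length (by omega)]
    simp

namespace IsLZEnd

variable {α : Type*} {S : List α} {fs gs : List (List α)}

theorem drop_eq (h : IsLZEnd S fs) {k : ℕ} (hk : k < fs.length) :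
    S.drop (fs.take k).flatten.length = fs[k] ++ (fs.drop (k + 1)).flatten := by
  rw [← h.1, flatten_eq_take_append_getElem_append_drop fs k hk, List.drop_left]

theorem length_eq (h : IsLZEnd S fs) {k : ℕ} (hk : k < fs.length) :
    S.length =
      (fs.take k).flatten.length + (fs[k].length + (fs.drop (k + 1)).flatten.length) := by
  rw [← h.1, flatten_eq_take_append_getElem_append_drop fs k hk, List.length_append,
    List.length_append]

theorem length_le_of_take_eq (hf : IsLZEnd S fs) (hg : IsLZEnd S gs) {k : ℕ}
    (hk : k < fs.length) (hkg : k < gs.length) (h : fs.take k = gs.take k) :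
    fs[k].length ≤ gs[k].length := by
  obtain ⟨hpos, ⟨p, hp, hsuf⟩, -⟩ := hf.2 k hk
  have hlen := hf.length_eq hk
  have hmax := (hg.2 k hkg).2.2 (fs[k].length - 1)
  rw [← h] at hmax
  have := hmax (by omega) ⟨p, hp, by
    have hp' : gs.take p = fs.take p := by
      have := congrArg (List.take p) h
      rw [List.take_take, List.take_take, min_eq_left hp] at this
      exact this.symm
    rw [hf.drop_eq hk, List.take_append_of_le_length (by omega), ← List.dropLast_eq_take, hp']
    exact hsuf⟩
  omega

theorem getElem_eq_of_take_eq (hf : IsLZEnd S fs) (hg : IsLZEnd S gs) {k : ℕ}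
    (hk : k < fs.length) (hkg : k < gs.length) (h : fs.take k = gs.take k) :
    fs[k] = gs[k] := by
  have hlen := le_antisymm (hf.length_le_of_take_eq hg hk hkg h)
    (hg.length_le_of_take_eq hf hkg hk h.symm)
  have heq := hf.drop_eq hk
  rw [h, hg.drop_eq hkg] at heq
  exact (List.append_inj_left heq hlen.symm).symm

theorem lt_length_of_take_eq (hf : IsLZEnd S fs) (hg : IsLZEnd S gs) {k : ℕ}
    (hk : k < fs.length) (h : fs.take k = gs.take k) : k < gs.length := by
  by_contra hkg
  have hlen := hf.length_eq hk
  have hpos := (hf.2 k hk).1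
  rw [h, List.take_of_length_le (not_lt.mp hkg), hg.1] at hlen
  omega

theorem take_eq (hf : IsLZEnd S fs) (hg : IsLZEnd S gs) (k : ℕ) : fs.take k = gs.take k := by
  induction k with
  | zero => simp
  | succ k ih =>
    by_cases hk : k < fs.length
    · have hkg := hf.lt_length_of_take_eq hg hk ih
      rw [← List.take_concat_get' fs k hk, ← List.take_concat_get' gs k hkg, ih,
        hf.getElem_eq_of_take_eq hg hk hkg ih]
    · have hkg : ¬ k < gs.length := fun hkg => hk (hg.lt_length_of_take_eq hf hkg ih.symm)
      rw [List.take_of_length_le (by omega), List.take_of_length_le (by omega)] at ih ⊢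
      exact ih

/-- The LZ-End parsing of a string is unique. -/
protected theorem unique (hf : IsLZEnd S fs) (hg : IsLZEnd S gs) : fs = gs := by
  have h := hf.take_eq hg (max fs.length gs.length)
  rwa [List.take_of_length_le (le_max_left _ _), List.take_of_length_le (le_max_right _ _)] at h

theorem getLast_suffix_drop (h : IsLZEnd S fs) {k : ℕ} (hk : k < fs.length) :
    fs.getD (fs.length - 1) [] <:+ S.drop (fs.take k).flatten.length := by
  have hdrop : S.drop (fs.take k).flatten.length = (fs.drop k).flatten := by
    rw [h.drop_eq hk, List.drop_eq_getElem_cons hk, List.flatten_cons]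
  rw [hdrop]
  exact getD_length_sub_one_suffix_flatten_drop fs k hk

theorem append_singleton (h : IsLZEnd S fs) (a : α)
    (hnocopy : ¬ ∃ p ≤ fs.length - 1,
      fs.getD (fs.length - 1) [] <:+ (fs.take p).flatten) :
    IsLZEnd (S ++ [a]) (fs ++ [[a]]) := by
  refine ⟨by simp [h.1], fun k hk => ?_⟩
  rw [List.length_append, List.length_singleton] at hk
  by_cases hkf : k < fs.length
  · have htake : ∀ p ≤ k, (fs ++ [[a]]).take p = fs.take p := fun p hp =>
      List.take_append_of_le_length (by omega)
    obtain ⟨hpos, ⟨p, hp, hsuf⟩, hmax⟩ := h.2 k hkf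
    have hlen := h.length_eq hkf
    rw [List.getElem_append_left hkf, htake k le_rfl]
    refine ⟨hpos, ⟨p, hp, by rwa [htake p hp]⟩, ?_⟩
    rintro l hl ⟨q, hq, hqs⟩
    rw [List.length_append, List.length_singleton] at hl
    rw [htake q hq, List.drop_append_of_le_length (by omega),
      List.take_append_of_le_length (by rw [List.length_drop]; omega)] at hqs
    by_cases hl' : (fs.take k).flatten.length + l + 1 ≤ S.length
    · exact hmax l hl' ⟨q, hq, hqs⟩
    · rw [List.take_of_length_le (by rw [List.length_drop]; omega)] at hqs
      exact absurd ⟨q, by omega, (h.getLast_suffix_drop hkf).trans hqs⟩ hnocopy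
  · obtain rfl : k = fs.length := by omega
    simp only [List.getElem_concat_length, List.take_left, h.1]
    refine ⟨by simp, ⟨0, by simp, by simp⟩, fun l hl _ => ?_⟩
    simp only [List.length_append, List.length_singleton] at hl ⊢
    omega

end IsLZEnd

/-- If `f_z` is not a suffix of any `f₁⋯f_p` with `p ≤ z-1`, then the LZ-End parsing of
`Sα` is `f₁, …, f_z, α` (a new single-character phrase begins). -/
theorem lzEnd_new_phrase_case {α : Type*} (S : List α) (a : α)
    (fs gs : List (List α)) (hz : 1 ≤ fs.length)
    (hfs : IsLZEnd S fs) (hgs : IsLZEnd (S ++ [a]) gs)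
    (hnocopy : ¬ ∃ p ≤ fs.length - 1,
      fs.getD (fs.length - 1) [] <:+ (fs.take p).flatten) :
    gs = fs ++ [[a]] := by
  exact hgs.unique (hfs.append_singleton a hnocopy)
end

section
/- Let S be a string of length n ≥ 1 with suffix array A. Then for all ranks a, b, c with 0 ≤ a < b < c ≤ n−1, it holds that lce(A[a], A[c]) = min( lce(A[a], A[b]), lce(A[b], A[c]) ). -/
/-- \`lcpLen u v\` is the length of the longest common prefix of \`u\` and \`v\`. -/
def lcpLen {α : Type*} [DecidableEq α] : List α → List α → ℕ
  | a :: u, b :: v => if a = b then lcpLen u v + 1 else 0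
  | _, _ => 0

/-- For lexicographically increasing lists `u < v < w`, the longest common prefix of `u` and `w`
is the shorter of those of `u`, `v` and of `v`, `w`. -/
theorem lcpLen_eq_min_of_lt {α : Type*} [LinearOrder α] {u v w : List α}
    (huv : u < v) (hvw : v < w) : lcpLen u w = min (lcpLen u v) (lcpLen v w) := by
  induction u generalizing v w with
  | nil => simp [lcpLen]
  | cons x u ih =>
    match v, w with
    | [], _ => simp at huv
    | _ :: _, [] => simp at hvw
    | y :: v, z :: w =>
      rw [List.cons_lt_cons_iff] at huv hvw
      simp only [lcpLen]
      rcases huv with hxy | ⟨rfl, huv⟩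
      · have hxz : x < z := by
          rcases hvw with hyz | ⟨rfl, -⟩
          exacts [hxy.trans hyz, hxy]
        simp [hxy.ne, hxz.ne]
      · rcases hvw with hxz | ⟨rfl, hvw⟩
        · simp [hxz.ne]
        · simp [ih huv hvw]

/-- For ranks `a < b < c` in the suffix array `A` of `S`, the longest common extension of
the suffixes at ranks `a` and `c` equals the minimum of the extensions at ranks
`(a,b)` and `(b,c)`. -/
theorem lce_min_rule {α : Type*} [LinearOrder α]
    (S : List α) (hn : 1 ≤ S.length) (A : ℕ → ℕ)
    (hAmem : ∀ r < S.length, A r < S.length)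
    (hAsorted : ∀ r s, r < s → s < S.length → S.drop (A r) < S.drop (A s)) :
    ∀ a b c, a < b → b < c → c ≤ S.length - 1 →
      lcpLen (S.drop (A a)) (S.drop (A c)) =
        min (lcpLen (S.drop (A a)) (S.drop (A b))) (lcpLen (S.drop (A b)) (S.drop (A c))) := by
  intro a b c hab hbc hc
  exact lcpLen_eq_min_of_lt (hAsorted a b hab (by omega)) (hAsorted b c hbc (by omega))
end
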